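/- Let V be a level zero irreducible highest weight module for the twisted full toroidal Lie algebra τ̃ having finite-dimensional weight spaces with respect to h̃, and assume that 𝔥_{0̄} does not act trivially on the highest weight space V₊ = {v ∈ V : τ̃₊·v = 0}. Then the centre 𝒵(m) acts trivially on V. -/

import Mathlib

open scoped BigOperators TensorProduct

noncomputable section

/-- Stage 1: a finite-dimensional simple complex Lie algebra `g` together with `n` commuting
automorphisms `σ i` of finite orders `m i`, fixed primitive roots of unity `ξ i`, and the
invariant nondegenerate symmetric bilinear form `bil`. -/
structure PreT where
  n : ℕ
  npos : 0 < n
  m : Fin n → ℕ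
  mpos : ∀ i, 0 < m i
  g : Type
  [gLR : LieRing g]
  [gLA : LieAlgebra ℂ g]
  gfin : FiniteDimensional ℂ g
  gsimple : LieAlgebra.IsSimple ℂ g
  σ : Fin n → (g ≃ₗ⁅ℂ⁆ g)
  σcomm : ∀ i j x, σ i (σ j x) = σ j (σ i x)
  σord : ∀ i x, (fun y => σ i y)^[m i] x = x
  ξ : Fin n → ℂ
  ξprim : ∀ i, IsPrimitiveRoot (ξ i) (m i)
  bil : g →ₗ[ℂ] g →ₗ[ℂ] ℂ
  bil_symm : ∀ x y, bil x y = bil y x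
  bil_invariant : ∀ x y z, bil ⁅x, y⁆ z = bil x ⁅y, z⁆
  bil_nondeg : ∀ x, (∀ y, bil x y = 0) → x = 0
  bil_aut : ∀ i x y, bil (σ i x) (σ i y) = bil x y

attribute [instance] PreT.gLR PreT.gLA

namespace PreT

variable (P : PreT)

/-- membership in the lattice `Γ = m₁ℤ ⊕ … ⊕ mₙℤ`. -/
def inΓ (r : Fin P.n → ℤ) : Prop := ∀ i, (P.m i : ℤ) ∣ r i

/-- the common eigenspace `𝔤_{k̄} = {x | σᵢ x = ξᵢ^{kᵢ} x}`. -/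
def gr (k : Fin P.n → ℤ) : Submodule ℂ P.g :=
  ⨅ i, LinearMap.ker
    ((P.σ i).toLinearEquiv.toLinearMap - P.ξ i ^ (k i) • (1 : Module.End ℂ P.g))

/-- Ĝ-characters: group homomorphisms `ℤⁿ/Γ → ℂˣ` presented as `Γ`-periodic functions. -/
def IsChar (χ : (Fin P.n → ℤ) → ℂ) : Prop :=
  (∀ k l, χ (k + l) = χ k * χ l) ∧ (∀ r, P.inΓ r → χ r = 1)

end PreT

/-- Stage 2: a Cartan subalgebra `h0 = 𝔥_{0̄}` of `𝔤_{0̄}` (abelian and self-normalizing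
in `𝔤_{0̄}`). -/
structure Cartan (P : PreT) where
  h0 : Submodule ℂ P.g
  h0_le : h0 ≤ P.gr 0
  h0_ne : h0 ≠ ⊥
  h0_abelian : ∀ x ∈ h0, ∀ y ∈ h0, ⁅x, y⁆ = 0
  h0_selfnorm : ∀ x ∈ P.gr 0, (∀ h ∈ h0, ⁅h, x⁆ ∈ h0) → x ∈ h0

namespace Cartan

variable {P : PreT} (C : Cartan P)

/-- the full weight space `{x ∈ 𝔤 | [h,x] = α(h)x ∀ h ∈ 𝔥_{0̄}}` of `𝔤` for `α ∈ 𝔥_{0̄}*`. -/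
def wtfull (α : Module.Dual ℂ ↥C.h0) : Submodule ℂ P.g :=
  ⨅ h : ↥C.h0, LinearMap.ker
    (LieAlgebra.ad ℂ P.g (h : P.g) - α h • (1 : Module.End ℂ P.g))

/-- the root space `𝔤_{k̄}(α)`. -/
def wtg (k : Fin P.n → ℤ) (α : Module.Dual ℂ ↥C.h0) : Submodule ℂ P.g :=
  P.gr k ⊓ C.wtfull α

/-- the set `Δ^× = Δ_{0,en}^×` of nonzero roots. -/
def Δen : Set (Module.Dual ℂ ↥C.h0) :=
  {α | α ≠ 0 ∧ ∃ k, C.wtg k α ≠ ⊥}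

/-- weights for `h̃ = 𝔥_{0̄} ⊕ ⊕ᵢℂKᵢ ⊕ ⊕ᵢℂdᵢ`: a functional on `𝔥_{0̄}` together with the
values on `K₁,…,Kₙ` and on `d₁,…,dₙ`. -/
abbrev Wt : Type := Module.Dual ℂ ↥C.h0 × (Fin P.n → ℂ) × (Fin P.n → ℂ)

/-- a real root `γ = α + δ_k` of `τ̃`, regarded as an element of `h̃*`. -/
def rootFn (α : Module.Dual ℂ ↥C.h0) (k : Fin P.n → ℤ) : C.Wt :=
  (α, 0, fun i => (k i : ℂ))

end Cartan

/-- Stage 3: the Lie-torus axioms together with a choice of a positive system and of coroots for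
the (extended) root system `Δ_{0,en}`. -/
structure Torus (P : PreT) (C : Cartan P) where
  /-- `𝔤_{0̄}` is a (finite-dimensional) simple Lie algebra: no proper nonzero ideals … -/
  g0_ideals : ∀ U : Submodule ℂ P.g, U ≤ P.gr 0 →
    (∀ x ∈ P.gr 0, ∀ u ∈ U, ⁅x, u⁆ ∈ U) → U = ⊥ ∨ U = P.gr 0
  /-- … and nonabelian. -/
  g0_nonabelian : ∃ x ∈ P.gr 0, ∃ y ∈ P.gr 0, ⁅x, y⁆ ≠ 0
  /-- condition (M): for `k̄ ≠ 0̄` with `𝔤_{k̄} ≠ 0`, `𝔤_{k̄} ≅ U ⊕ W` with `U` a trivial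
  `𝔤_{0̄}`-module and `W` zero or irreducible of dimension `> 1` with weights in `Δ_{0,en}`. -/
  cond_M : ∀ k : Fin P.n → ℤ, ¬ P.inΓ k → P.gr k ≠ ⊥ →
    ∃ U W : Submodule ℂ P.g, U ≤ P.gr k ∧ W ≤ P.gr k ∧ U ⊓ W = ⊥ ∧ U ⊔ W = P.gr k ∧
      (∀ x ∈ P.gr 0, ∀ u ∈ U, ⁅x, u⁆ = 0) ∧
      (W = ⊥ ∨
        ((∀ U' : Submodule ℂ P.g, U' ≤ W →
            (∀ x ∈ P.gr 0, ∀ u ∈ U', ⁅x, u⁆ ∈ U') → U' = ⊥ ∨ U' = W) ∧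
          1 < Module.finrank ℂ ↥W ∧
          W ≤ ⨆ α ∈ insert (0 : Module.Dual ℂ ↥C.h0) C.Δen, C.wtfull α))
  /-- condition (iii): the group generated by `σ₁,…,σₙ` has order `m₁ ⋯ mₙ`. -/
  ord_faithful : ∀ k : Fin P.n → ℤ,
    (∀ l, P.gr l ≠ ⊥ → (∏ i, P.ξ i ^ (k i * l i)) = 1) → P.inΓ k
  /-- a positive system for `Δ_{0,en}`. -/
  pos : Set (Module.Dual ℂ ↥C.h0)
  pos_sub : pos ⊆ C.Δen
  pos_total : ∀ α ∈ C.Δen, α ∈ pos ∨ -α ∈ pos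
  pos_disj : ∀ α ∈ pos, -α ∉ pos
  pos_add : ∀ α ∈ pos, ∀ β ∈ pos, α + β ∈ C.Δen → α + β ∈ pos
  /-- coroots `α∨ ∈ 𝔥_{0̄}`. -/
  coroot : Module.Dual ℂ ↥C.h0 → ↥C.h0
  coroot_two : ∀ α ∈ C.Δen, α (coroot α) = 2
  coroot_neg : ∀ α ∈ C.Δen, coroot (-α) = - coroot α
  /-- `cnorm α = 2/(α|α)`, characterized via the bilinear form. -/
  cnorm : Module.Dual ℂ ↥C.h0 → ℂ
  cnorm_spec : ∀ α ∈ C.Δen, ∀ h : ↥C.h0,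
    P.bil ((coroot α : P.g)) ((h : P.g)) = cnorm α * α h

namespace Torus

variable {P : PreT} {C : Cartan P} (T : Torus P C)

/-- evaluation `λ(γ∨)` of a weight `λ` at the coroot `γ∨ = α∨ + (2/(α|α)) Σᵢ kᵢKᵢ` of the real
root `γ = α + δ_k`. -/
def corootEval (α : Module.Dual ℂ ↥C.h0) (k : Fin P.n → ℤ) (w : C.Wt) : ℂ :=
  w.1 (T.coroot α) + T.cnorm α * ∑ i, (k i : ℂ) * w.2.1 i

/-- the reflection `r_γ(λ) = λ - λ(γ∨)γ` on `h̃*`. -/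
def reflFn (α : Module.Dual ℂ ↥C.h0) (k : Fin P.n → ℤ) : Function.End C.Wt :=
  fun w => w - T.corootEval α k w • C.rootFn α k

/-- the Weyl group `W` of `τ̃`, generated by the reflections in the real roots
(realized inside the monoid of self-maps of `h̃*`; as the generators are involutions this
coincides with the generated group). -/
def weyl : Submonoid (Function.End C.Wt) :=
  Submonoid.closure {f | ∃ α ∈ C.Δen, ∃ k, f = T.reflFn α k}

end Torus

/-- Stage 4: the twisted full toroidal Lie algebra
`τ̃ = LT ⊕ 𝒵(m) ⊕ 𝒟(m)`.  The elements `E k x` (for `x ∈ 𝔤_{k̄}`), `K r i` and `Dop r i`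
(for `r ∈ Γ`) realize `x ⊗ t^k`, `t^r Kᵢ` and `t^r dᵢ`, subject to the standard toroidal
bracket relations, with 2-cocycle `φ = c1 • φ₁ + c2 • φ₂`. -/
structure Toroidal (P : PreT) (C : Cartan P) (T : Torus P C) where
  τ : Type
  [τLR : LieRing τ]
  [τLA : LieAlgebra ℂ τ]
  E : (Fin P.n → ℤ) → P.g →ₗ[ℂ] τ
  K : (Fin P.n → ℤ) → Fin P.n → τ
  Dop : (Fin P.n → ℤ) → Fin P.n → τ
  c1 : ℂ
  c2 : ℂ
  K_not : ∀ r i, ¬ P.inΓ r → K r i = 0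
  Dop_not : ∀ r i, ¬ P.inΓ r → Dop r i = 0
  /-- the relation `Σᵢ rᵢ t^r Kᵢ = 0` coming from `dA(m)` in `𝒵(m) = Ω_{A(m)}/dA(m)`. -/
  K_dA : ∀ r, P.inΓ r → ∑ i, (r i : ℂ) • K r i = 0
  br_EE : ∀ k l x y, x ∈ P.gr k → y ∈ P.gr l →
    ⁅E k x, E l y⁆ = E (k + l) ⁅x, y⁆ + P.bil x y • ∑ i, (k i : ℂ) • K (k + l) i
  br_EK : ∀ k x, x ∈ P.gr k → ∀ r i, ⁅E k x, K r i⁆ = 0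
  br_KK : ∀ r s i j, ⁅K r i, K s j⁆ = 0
  br_DK : ∀ r s, P.inΓ r → P.inΓ s → ∀ i j,
    ⁅Dop r i, K s j⁆ = (s i : ℂ) • K (r + s) j +
      (if i = j then (1 : ℂ) else 0) • ∑ p, (r p : ℂ) • K (r + s) p
  br_DD : ∀ r s, P.inΓ r → P.inΓ s → ∀ i j,
    ⁅Dop r i, Dop s j⁆ = (s i : ℂ) • Dop (r + s) j - (r j : ℂ) • Dop (r + s) i +
      (c1 * (-(s i : ℂ) * (r j : ℂ)) + c2 * ((r i : ℂ) * (s j : ℂ))) •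
        ∑ p, (r p : ℂ) • K (r + s) p
  br_DE : ∀ r, P.inΓ r → ∀ i k x, x ∈ P.gr k → ⁅Dop r i, E k x⁆ = (k i : ℂ) • E (r + k) x
  span_top : Submodule.span ℂ
    ({t | ∃ k x, x ∈ P.gr k ∧ t = E k x} ∪ {t | ∃ r i, P.inΓ r ∧ t = K r i} ∪
      {t | ∃ r i, P.inΓ r ∧ t = Dop r i}) = ⊤
  E_inj : ∀ k x, x ∈ P.gr k → E k x = 0 → x = 0

attribute [instance] Toroidal.τLR Toroidal.τLA

namespace Toroidal

variable {P : PreT} {C : Cartan P} {T : Torus P C} (X : Toroidal P C T)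

/-- the generators `𝔤_{k̄}(α) ⊗ ℂt^k`, `α` positive, of `τ̃₊`. -/
def tauP : Set X.τ :=
  {t | ∃ α ∈ T.pos, ∃ k x, x ∈ C.wtg k α ∧ t = X.E k x}

/-- the generators `𝔤_{k̄}(α) ⊗ ℂt^k`, `α` negative, of `τ̃₋`. -/
def tauM : Set X.τ :=
  {t | ∃ α, -α ∈ T.pos ∧ ∃ k x, x ∈ C.wtg k α ∧ t = X.E k x}

/-- the generators `𝔤_{k̄}(0) ⊗ ℂt^k`, `t^rKᵢ`, `t^rdᵢ` of `τ̃₀`. -/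
def tauZ : Set X.τ :=
  {t | (∃ k x, x ∈ C.wtg k 0 ∧ t = X.E k x) ∨
    (∃ r i, P.inΓ r ∧ (t = X.K r i ∨ t = X.Dop r i))}

/-- the generators of `τ̂ = LT ⊕ 𝒟(m)`. -/
def tauHat : Set X.τ :=
  {t | (∃ k x, x ∈ P.gr k ∧ t = X.E k x) ∨ (∃ r i, P.inΓ r ∧ t = X.Dop r i)}

/-- the element `I(u,r) = D(u,r) - D(u,0) = Σᵢ uᵢ t^r dᵢ - Σᵢ uᵢ dᵢ`. -/
def Iop (u : Fin P.n → ℂ) (r : Fin P.n → ℤ) : X.τ :=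
  ∑ i, u i • X.Dop r i - ∑ i, u i • X.Dop 0 i

/-- generators of `L̃ = I ⋉ L(g̊,σ)`, where `g̊` is the centralizer of `𝔥_{0̄}` in `𝔤`. -/
def Ltil : Set X.τ :=
  {t | (∃ u r, P.inΓ r ∧ t = X.Iop u r) ∨
    (∃ k x, x ∈ P.gr k ∧ x ∈ C.wtfull 0 ∧ t = X.E k x)}

/-- generators of `I ⋉ (𝔥_{0̄} ⊗ A(m))`. -/
def IhGen : Set X.τ :=
  {t | (∃ u r, P.inΓ r ∧ t = X.Iop u r) ∨
    (∃ r h, P.inΓ r ∧ h ∈ C.h0 ∧ h ∈ P.gr r ∧ h ∈ C.wtfull 0 ∧ t = X.E r h)}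

end Toroidal

/-- a representation of `τ̃` on a complex vector space. -/
structure TRep {P : PreT} {C : Cartan P} {T : Torus P C} (X : Toroidal P C T) where
  V : Type
  [Vadd : AddCommGroup V]
  [Vmod : Module ℂ V]
  ρ : X.τ →ₗ[ℂ] Module.End ℂ V
  ρ_lie : ∀ a b : X.τ, ρ ⁅a, b⁆ = ρ a * ρ b - ρ b * ρ a

attribute [instance] TRep.Vadd TRep.Vmod

namespace TRep

variable {P : PreT} {C : Cartan P} {T : Torus P C} {X : Toroidal P C T} (M : TRep X)

/-- the weight space `V_w` with respect to `h̃`. -/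
def wtSp (w : C.Wt) : Submodule ℂ M.V :=
  (⨅ h : ↥C.h0, LinearMap.ker (M.ρ (X.E 0 (h : P.g)) - w.1 h • (1 : Module.End ℂ M.V))) ⊓
  (⨅ i, LinearMap.ker (M.ρ (X.K 0 i) - w.2.1 i • (1 : Module.End ℂ M.V))) ⊓
  (⨅ i, LinearMap.ker (M.ρ (X.Dop 0 i) - w.2.2 i • (1 : Module.End ℂ M.V)))

/-- the set `P(V)` of weights of `V`. -/
def wts : Set C.Wt := {w | M.wtSp w ≠ ⊥}

/-- `V` is a weight module: `V = ⊕_{λ ∈ h̃*} V_λ`. -/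
def IsWeight : Prop := (⨆ w : C.Wt, M.wtSp w) = ⊤

/-- `V` has finite-dimensional weight spaces. -/
def FinWt : Prop := ∀ w : C.Wt, FiniteDimensional ℂ ↥(M.wtSp w)

/-- integrability: `V` is a weight module on which all the root vectors
`x ∈ 𝔤_{k̄}(α) ⊗ ℂt^k`, `α ≠ 0`, act locally nilpotently. -/
def Integrable : Prop :=
  M.IsWeight ∧ ∀ (k : Fin P.n → ℤ) (α : Module.Dual ℂ ↥C.h0), α ≠ 0 →
    ∀ x ∈ C.wtg k α, ∀ v : M.V, ∃ N : ℕ, (M.ρ (X.E k x) ^ N) v = 0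

/-- level zero: the central elements `K₁, …, Kₙ` act trivially. -/
def LevelZero : Prop := ∀ i, M.ρ (X.K 0 i) = 0

/-- irreducibility of `V` over `τ̃`. -/
def Irr : Prop :=
  Nontrivial M.V ∧
    ∀ U : Submodule ℂ M.V, (∀ t : X.τ, ∀ v ∈ U, M.ρ t v ∈ U) → U = ⊥ ∨ U = ⊤

/-- the Lie torus `LT` acts non-trivially on `V`. -/
def LTnontrivial : Prop := ∃ k x, x ∈ P.gr k ∧ M.ρ (X.E k x) ≠ 0

/-- the highest weight space `V₊ = {v ∈ V | τ̃₊ ⬝ v = 0}`. -/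
def Vplus : Submodule ℂ M.V := ⨅ t ∈ X.tauP, LinearMap.ker (M.ρ t)

/-- `U(τ̃₀)v`: the smallest subspace of `V` containing `v` and invariant under `τ̃₀`. -/
def u0span (v : M.V) : Submodule ℂ M.V :=
  sInf {U | v ∈ U ∧ ∀ t ∈ X.tauZ, ∀ u ∈ U, M.ρ t u ∈ U}

/-- `V` is a level zero highest weight module for `τ̃` (Definition 3.3). -/
def IsHW : Prop :=
  ∃ v : M.V, v ≠ 0 ∧ (∃ w : C.Wt, v ∈ M.wtSp w) ∧
    (∀ U : Submodule ℂ M.V, (∀ t : X.τ, ∀ u ∈ U, M.ρ t u ∈ U) → v ∈ U → U = ⊤) ∧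
    (∀ t ∈ X.tauP, M.ρ t v = 0) ∧
    (∀ U : Submodule ℂ M.V, U ≤ M.u0span v →
      (∀ t ∈ X.tauZ, ∀ u ∈ U, M.ρ t u ∈ U) → U = ⊥ ∨ U = M.u0span v) ∧
    (∀ i, M.ρ (X.K 0 i) = 0)

/-- simultaneous eigenspace for the degree derivations `d₁,…,dₙ`. -/
def dEig (b : Fin P.n → ℂ) : Submodule ℂ M.V :=
  ⨅ i, LinearMap.ker (M.ρ (X.Dop 0 i) - b i • (1 : Module.End ℂ M.V))

/-- the graded piece `V₊(k) = {v ∈ V₊ | dᵢ v = (Λ(dᵢ)+kᵢ) v}`. -/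
def VplusGr (Λ : C.Wt) (k : Fin P.n → ℤ) : Submodule ℂ M.V :=
  M.Vplus ⊓ M.dEig (fun i => Λ.2.2 i + (k i : ℂ))

/-- `𝒵(m)` acts trivially on `V`. -/
def Ztrivial : Prop := ∀ r, P.inΓ r → ∀ i, M.ρ (X.K r i) = 0

end TRep

/-- isomorphism of representations of `τ̃`. -/
def TRepIso {P : PreT} {C : Cartan P} {T : Torus P C} {X : Toroidal P C T}
    (M N : TRep X) : Prop :=
  ∃ e : M.V ≃ₗ[ℂ] N.V, ∀ t v, e (M.ρ t v) = N.ρ t (e v)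

/-- A commuting family of endomorphisms of a nonzero finite-dimensional complex vector space has
a common eigenvector. -/
theorem exists_common_eigenvector {ι V : Type*} [AddCommGroup V] [Module ℂ V]
    [FiniteDimensional ℂ V] [Nontrivial V] (T : ι → Module.End ℂ V)
    (hT : ∀ i j v, T i (T j v) = T j (T i v)) :
    ∃ v : V, v ≠ 0 ∧ ∃ c : ι → ℂ, ∀ i, T i v = c i • v := by
  obtain ⟨W, ⟨hW0, hWs⟩, hmin⟩ := (wellFounded_lt (α := Submodule ℂ V)).has_min
    {W | W ≠ ⊥ ∧ ∀ i, ∀ v ∈ W, T i v ∈ W} ⟨⊤, top_ne_bot, fun _ _ _ => trivial⟩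
  have key : ∀ i, ∃ c : ℂ, ∀ v ∈ W, T i v = c • v := by
    intro i
    have : Nontrivial W := Submodule.nontrivial_iff_ne_bot.mpr hW0
    obtain ⟨c, hc⟩ := Module.End.exists_eigenvalue ((T i).restrict (hWs i))
    obtain ⟨x, hx⟩ := hc.exists_hasEigenvector
    have hx1 : T i x = c • (x : V) := congrArg Subtype.val hx.apply_eq_smul
    refine ⟨c, fun v hv => ?_⟩
    have hle : W ⊓ LinearMap.ker (T i - c • 1) ≤ W := inf_le_left
    have hnot := hmin (W ⊓ LinearMap.ker (T i - c • 1)) ⟨?_, ?_⟩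
    · have heq := eq_of_le_of_not_lt hle hnot
      rw [← heq] at hv
      simpa [sub_eq_zero] using hv.2
    · rw [Submodule.ne_bot_iff]
      exact ⟨x, ⟨x.2, by simp [hx1]⟩, fun h => hx.2 (Subtype.ext h)⟩
    · rintro j v ⟨hv, hv'⟩
      refine ⟨hWs j v hv, ?_⟩
      have : T i v = c • v := by simpa [sub_eq_zero] using hv'
      simp [hT i j, this]
  choose c hc using key
  obtain ⟨v, hv, hv0⟩ := W.ne_bot_iff.mp hW0
  exact ⟨v, hv0, c, fun i => hc i v hv⟩

/-- If a commuting family of endomorphisms of a finite-dimensional complex vector space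
annihilates a nonzero functional, then it annihilates a nonzero vector. -/
theorem exists_common_ker_of_invariant_functional {ι V : Type*} [AddCommGroup V] [Module ℂ V]
    [FiniteDimensional ℂ V] (T : ι → Module.End ℂ V)
    (hT : ∀ i j v, T i (T j v) = T j (T i v)) (φ : V →ₗ[ℂ] ℂ) (hφ : φ ≠ 0)
    (hφT : ∀ i v, φ (T i v) = 0) : ∃ v : V, v ≠ 0 ∧ ∀ i, T i v = 0 := by
  obtain ⟨W, ⟨⟨w, hwW, hw0⟩, hWs⟩, hmin⟩ := (wellFounded_lt (α := Submodule ℂ V)).has_min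
    {W | (∃ w ∈ W, φ w ≠ 0) ∧ ∀ i, ∀ v ∈ W, T i v ∈ W}
    ⟨⊤, by
      obtain ⟨w, hw⟩ := DFunLike.ne_iff.mp hφ
      exact ⟨w, trivial, hw⟩, fun _ _ _ => trivial⟩
  have key : ∀ i, ∃ N : ℕ, ∀ v ∈ W, (T i ^ N) v = 0 := by
    intro i
    obtain ⟨N, hN, hN1⟩ := ((LinearMap.eventually_isCompl_ker_pow_range_pow
      ((T i).restrict (hWs i))).and (Filter.eventually_ge_atTop 1)).exists
    refine ⟨N, fun v hv => ?_⟩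
    have hle : W ⊓ LinearMap.ker (T i ^ N) ≤ W := inf_le_left
    have hnot := hmin (W ⊓ LinearMap.ker (T i ^ N)) ⟨?_, ?_⟩
    · have heq := eq_of_le_of_not_lt hle hnot
      rw [← heq] at hv
      exact hv.2
    · have hmem : (⟨w, hwW⟩ : W) ∈ (⊤ : Submodule ℂ W) := trivial
      rw [← hN.sup_eq_top] at hmem
      obtain ⟨a, ha, b, ⟨b', rfl⟩, hab⟩ := Submodule.mem_sup.mp hmem
      rw [Module.End.pow_restrict] at ha hab
      have hab' : (a : V) + (T i ^ N) b' = w := congrArg Subtype.val hab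
      have ha' : (T i ^ N) a = 0 := congrArg Subtype.val (LinearMap.mem_ker.mp ha)
      refine ⟨a, ⟨a.2, ha'⟩, fun h0 => hw0 ?_⟩
      obtain ⟨k, rfl⟩ := Nat.exists_eq_succ_of_ne_zero (Nat.one_le_iff_ne_zero.mp hN1)
      rw [← hab', map_add, h0, Nat.succ_eq_add_one, pow_succ']
      simp [hφT]
    · rintro j v ⟨hv, hv'⟩
      refine ⟨hWs j v hv, ?_⟩
      have hcomm : Commute (T i ^ N) (T j) :=
        Commute.pow_left (LinearMap.ext fun v => hT i j v) N
      have := LinearMap.congr_fun hcomm.eq v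
      simp only [Module.End.mul_apply] at this
      have h0 : (T i ^ N) v = 0 := hv'
      change (T i ^ N) (T j v) = 0
      rw [this, h0, map_zero]
  have : Nontrivial W := ⟨⟨w, hwW⟩, 0, fun h => hw0 (by
    have := congrArg Subtype.val h
    simp at this; simp [this])⟩
  obtain ⟨v, hv0, c, hc⟩ := exists_common_eigenvector (fun i => (T i).restrict (hWs i))
    (fun i j v => Subtype.ext (hT i j v))
  have hv0' : (v : V) ≠ 0 := fun h => hv0 (Subtype.ext h)
  refine ⟨v, hv0', fun i => ?_⟩
  have hci : T i v = c i • (v : V) := congrArg Subtype.val (hc i)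
  obtain ⟨N, hN⟩ := key i
  have hN' : ∀ N : ℕ, (T i ^ N) (v : V) = c i ^ N • (v : V) := fun N => by
    induction N with
    | zero => simp
    | succ N ih => rw [pow_succ', Module.End.mul_apply, ih, map_smul, hci, smul_smul, pow_succ]
  have h0 := hN' N
  rw [hN v v.2] at h0
  have : c i = 0 := by
    by_contra hne
    exact (smul_ne_zero (pow_ne_zero N hne) hv0') h0.symm
  rw [hci, this, zero_smul]

/-- On a finite-dimensional complex vector space, commuting endomorphisms each of which is a
commutator of two endomorphisms commuting with it have a common kernel vector. -/
theorem exists_common_ker_of_commutators {ι V : Type*} [AddCommGroup V] [Module ℂ V]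
    [FiniteDimensional ℂ V] [Nontrivial V] (Z X Y : ι → Module.End ℂ V)
    (hZ : ∀ i j v, Z i (Z j v) = Z j (Z i v)) (hZX : ∀ i v, Z i (X i v) = X i (Z i v))
    (hZY : ∀ i v, Z i (Y i v) = Y i (Z i v))
    (hXY : ∀ i v, Z i v = X i (Y i v) - Y i (X i v)) :
    ∃ v : V, v ≠ 0 ∧ ∀ i, Z i v = 0 := by
  obtain ⟨v, hv0, c, hc⟩ := exists_common_eigenvector Z hZ
  refine ⟨v, hv0, fun i => ?_⟩
  let W : Submodule ℂ V := LinearMap.ker (Z i - c i • 1)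
  have hW : ∀ u, u ∈ W ↔ Z i u = c i • u := fun u => by simp [W, sub_eq_zero]
  have hX : ∀ u ∈ W, X i u ∈ W := fun u hu => by
    rw [hW] at hu ⊢; rw [hZX, hu, map_smul]
  have hY : ∀ u ∈ W, Y i u ∈ W := fun u hu => by
    rw [hW] at hu ⊢; rw [hZY, hu, map_smul]
  have heq : (X i).restrict hX * (Y i).restrict hY - (Y i).restrict hY * (X i).restrict hX
      = c i • (1 : Module.End ℂ W) := by
    ext u
    have h1 := (hW u).mp u.2
    rw [hXY] at h1
    exact h1
  have htr := congrArg (LinearMap.trace ℂ W) heq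
  rw [map_sub, LinearMap.trace_mul_comm, sub_self, map_smul, LinearMap.trace_one] at htr
  have hdim : (Module.finrank ℂ W : ℂ) ≠ 0 := by
    have : Nontrivial W := ⟨⟨v, (hW v).mpr (hc i)⟩, 0, fun h => hv0 (congrArg Subtype.val h)⟩
    exact_mod_cast (Module.finrank_pos (R := ℂ) (M := W)).ne'
  have : c i = 0 := (mul_eq_zero.mp htr.symm).resolve_right hdim
  rw [hc, this, zero_smul]

/-- A subspace on which an endomorphism is annihilated by a product of linear factors is
finite-dimensional as soon as all its eigenspaces are. -/
theorem fg_of_prod_eq_zero {V : Type*} [AddCommGroup V] [Module ℂ V] (t : Module.End ℂ V)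
    (s : Multiset ℂ) : ∀ (Y : Submodule ℂ V), (∀ y ∈ Y, t y ∈ Y) →
    (∀ c : ℂ, (Y ⊓ LinearMap.ker (t - c • 1)).FG) →
    (∀ y ∈ Y, Polynomial.aeval t (s.map fun c => Polynomial.X - Polynomial.C c).prod y = 0) →
    Y.FG := by
  induction s using Multiset.induction_on with
  | empty =>
    intro Y _ _ h
    have : Y = ⊥ := (Submodule.eq_bot_iff _).mpr fun y hy => by simpa using h y hy
    exact this ▸ Submodule.fg_bot
  | cons c s ih =>
    intro Y hY hfg h
    have hY' : ∀ y ∈ Y, (t - c • 1) y ∈ Y := fun y hy =>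
      Y.sub_mem (hY y hy) (Y.smul_mem c hy)
    refine Submodule.fg_of_fg_map_of_fg_inf_ker (t - c • 1) (ih _ ?_ ?_ ?_) (hfg c)
    · rintro _ ⟨y, hy, rfl⟩
      exact ⟨t y, hY y hy, by simp⟩
    · intro d
      have hle : Y.map (t - c • 1) ⊓ LinearMap.ker (t - d • 1)
          ≤ Y ⊓ LinearMap.ker (t - d • 1) :=
        inf_le_inf_right _ (Submodule.map_le_iff_le_comap.mpr hY')
      have : FiniteDimensional ℂ ↥(Y ⊓ LinearMap.ker (t - d • 1)) :=
        Module.Finite.iff_fg.mpr (hfg d)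
      exact Module.Finite.iff_fg.mp (Submodule.finiteDimensional_of_le hle)
    · rintro _ ⟨y, hy, rfl⟩
      have := h y hy
      rw [Multiset.map_cons, Multiset.prod_cons, mul_comm, map_mul] at this
      simpa [Algebra.algebraMap_eq_smul_one] using this

/-- A subspace stable under finitely many commuting endomorphisms, each annihilated by a nonzero
polynomial on it, is finite-dimensional as soon as all the joint eigenspaces in it are. -/
theorem fg_of_joint_eigenspaces_fg {V : Type*} [AddCommGroup V] [Module ℂ V] (r : ℕ) :
    ∀ (t : Fin r → Module.End ℂ V) (Y : Submodule ℂ V),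
    (∀ i j v, t i (t j v) = t j (t i v)) → (∀ i, ∀ y ∈ Y, t i y ∈ Y) →
    (∀ i, ∃ p : Polynomial ℂ, p ≠ 0 ∧ ∀ y ∈ Y, Polynomial.aeval (t i) p y = 0) →
    (∀ c : Fin r → ℂ, (Y ⊓ ⨅ i, LinearMap.ker (t i - c i • 1)).FG) → Y.FG := by
  induction r with
  | zero =>
    intro t Y _ _ _ h
    simpa using h 0
  | succ r ih =>
    intro t Y hcomm hY hp hfg
    obtain ⟨p, hp0, hpY⟩ := hp 0
    refine fg_of_prod_eq_zero (t 0) p.roots Y (hY 0) (fun c => ?_) (fun y hy => ?_)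
    · refine ih (fun i => t i.succ) _ (fun i j => hcomm _ _) ?_ ?_ ?_
      · rintro i y ⟨hy, hy'⟩
        refine ⟨hY _ y hy, ?_⟩
        have : t 0 y = c • y := by simpa [sub_eq_zero] using hy'
        simp [hcomm 0 i.succ, this]
      · intro i
        obtain ⟨q, hq0, hq⟩ := hp i.succ
        exact ⟨q, hq0, fun y hy => hq y hy.1⟩
      · intro d
        have heq : Y ⊓ LinearMap.ker (t 0 - c • 1) ⊓ ⨅ i : Fin r, LinearMap.ker (t i.succ - d i • 1)
            = Y ⊓ ⨅ i, LinearMap.ker (t i - (Fin.cons c d : Fin (r + 1) → ℂ) i • 1) := by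
          ext v
          simp [Fin.forall_fin_succ, and_assoc]
        rw [heq]
        exact hfg (Fin.cons c d)
    · have h1 := hpY y hy
      rw [(IsAlgClosed.splits p).eq_prod_roots, map_mul, Polynomial.aeval_C,
        Module.End.mul_apply, Module.algebraMap_end_apply] at h1
      exact (smul_eq_zero.mp h1).resolve_left (Polynomial.leadingCoeff_ne_zero.mpr hp0)

namespace PreT

variable (P : PreT)

theorem mem_gr {k : Fin P.n → ℤ} {x : P.g} :
    x ∈ P.gr k ↔ ∀ i, P.σ i x = P.ξ i ^ k i • x := by
  simp [gr, sub_eq_zero]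

theorem ξ_ne_zero (i : Fin P.n) : P.ξ i ≠ 0 :=
  (P.ξprim i).ne_zero (P.mpos i).ne'

theorem lie_mem_gr {k l : Fin P.n → ℤ} {x y : P.g} (hx : x ∈ P.gr k) (hy : y ∈ P.gr l) :
    ⁅x, y⁆ ∈ P.gr (k + l) := by
  rw [mem_gr] at *
  intro i
  rw [LieEquiv.map_lie, hx, hy, smul_lie, lie_smul, smul_smul, Pi.add_apply,
    zpow_add₀ (P.ξ_ne_zero i)]

theorem gr_add_of_inΓ (k : Fin P.n → ℤ) {r : Fin P.n → ℤ} (hr : P.inΓ r) :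
    P.gr (r + k) = P.gr k := by
  have h : ∀ i, P.ξ i ^ (r + k) i = P.ξ i ^ k i := fun i => by
    obtain ⟨c, hc⟩ := hr i
    rw [Pi.add_apply, zpow_add₀ (P.ξ_ne_zero i), hc, zpow_mul, zpow_natCast,
      (P.ξprim i).pow_eq_one, one_zpow, one_mul]
  ext x
  simp only [mem_gr, h]

theorem gr_of_inΓ {r : Fin P.n → ℤ} (hr : P.inΓ r) : P.gr r = P.gr 0 := by
  simpa using P.gr_add_of_inΓ 0 hr

theorem inΓ_zero : P.inΓ 0 := fun i => by simp

variable {P} in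
theorem inΓ.add {r s : Fin P.n → ℤ} (hr : P.inΓ r) (hs : P.inΓ s) : P.inΓ (r + s) :=
  fun i => dvd_add (hr i) (hs i)

variable {P} in
theorem inΓ.sub {r s : Fin P.n → ℤ} (hr : P.inΓ r) (hs : P.inΓ s) : P.inΓ (r - s) :=
  fun i => dvd_sub (hr i) (hs i)

/-- The invariant form pairs `𝔤_{k̄}` and `𝔤_{-k̄}` nondegenerately. -/
theorem exists_bil_ne_zero {k : Fin P.n → ℤ} {x : P.g} (hx : x ∈ P.gr k) (hx0 : x ≠ 0) :
    ∃ y ∈ P.gr (-k), P.bil x y ≠ 0 := by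
  rw [mem_gr] at hx
  have key : ∀ s : Finset (Fin P.n), ∃ y, P.bil x y ≠ 0 ∧
      ∀ i ∈ s, P.σ i y = P.ξ i ^ (-k i) • y := by
    intro s
    induction s using Finset.induction_on with
    | empty =>
      by_contra! h
      exact hx0 (P.bil_nondeg x fun y => by_contra fun hy => by simpa using h y hy)
    | insert a s _ ih =>
      obtain ⟨y, hy0, hy⟩ := ih
      let τ : Module.End ℂ P.g := (P.ξ a ^ k a) • (P.σ a).toLinearEquiv.toLinearMap
      have hτ : ∀ z, τ z = P.ξ a ^ k a • P.σ a z := fun z => rfl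
      have hτbil : ∀ z, P.bil x (τ z) = P.bil x z := fun z => by
        have := P.bil_aut a x z
        rw [hx, map_smul, LinearMap.smul_apply] at this
        rw [hτ, map_smul, this]
      have hτpow : ∀ N : ℕ, P.bil x ((τ ^ N) y) = P.bil x y := fun N => by
        induction N with
        | zero => simp
        | succ N ih => rw [pow_succ', Module.End.mul_apply, hτbil, ih]
      have hpow : ∀ (N : ℕ) z, (τ ^ N) z = (P.ξ a ^ k a) ^ N • (fun z => P.σ a z)^[N] z := by
        intro N z
        induction N with
        | zero => simp
        | succ N ih =>
          rw [pow_succ', Module.End.mul_apply, ih, hτ, map_smul, smul_smul,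
            Function.iterate_succ_apply', pow_succ']
      have hτm : ∀ z, (τ ^ P.m a) z = z := fun z => by
        rw [hpow, P.σord, ← zpow_natCast, ← zpow_mul, mul_comm, zpow_mul, zpow_natCast,
          (P.ξprim a).pow_eq_one, one_zpow, one_smul]
      have hτσ : ∀ i z, P.σ i (τ z) = τ (P.σ i z) := fun i z => by
        rw [hτ, hτ, map_smul, P.σcomm]
      have hτσpow : ∀ i (N : ℕ) z, P.σ i ((τ ^ N) z) = (τ ^ N) (P.σ i z) := fun i N z => by
        induction N with
        | zero => simp
        | succ N ih => rw [pow_succ', Module.End.mul_apply, Module.End.mul_apply, hτσ, ih]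
      refine ⟨∑ N ∈ Finset.range (P.m a), (τ ^ N) y, ?_, fun i hi => ?_⟩
      · rw [map_sum, Finset.sum_congr rfl fun N _ => hτpow N, Finset.sum_const,
          Finset.card_range, nsmul_eq_mul]
        exact mul_ne_zero (by exact_mod_cast (P.mpos a).ne') hy0
      · rcases Finset.mem_insert.mp hi with rfl | hi
        · have h1 : τ (∑ N ∈ Finset.range (P.m i), (τ ^ N) y)
              = ∑ N ∈ Finset.range (P.m i), (τ ^ N) y := by
            have h2 := Finset.sum_range_succ (fun N => (τ ^ N) y) (P.m i)
            rw [Finset.sum_range_succ', hτm, pow_zero, Module.End.one_apply] at h2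
            have h3 := add_right_cancel h2
            rw [map_sum, ← h3]
            exact Finset.sum_congr rfl fun N _ => by rw [pow_succ', Module.End.mul_apply]
          rw [hτ] at h1
          conv_rhs => rw [← h1]
          rw [smul_smul, ← zpow_add₀ (P.ξ_ne_zero i), neg_add_cancel, zpow_zero, one_smul]
        · rw [map_sum, Finset.smul_sum]
          exact Finset.sum_congr rfl fun N _ => by rw [hτσpow, hy i hi, map_smul]
  obtain ⟨y, hy0, hy⟩ := key Finset.univ
  exact ⟨y, (P.mem_gr).mpr fun i => hy i (Finset.mem_univ i), hy0⟩

end PreT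

namespace Cartan

variable {P : PreT} (C : Cartan P)

theorem mem_wtg {k : Fin P.n → ℤ} {α : Module.Dual ℂ C.h0} {x : P.g} :
    x ∈ C.wtg k α ↔ x ∈ P.gr k ∧ ∀ h : C.h0, ⁅(h : P.g), x⁆ = α h • x := by
  simp [wtg, wtfull, sub_eq_zero]

theorem lie_mem_gr_of_mem_h0 {k : Fin P.n → ℤ} {x h : P.g} (hh : h ∈ C.h0) (hx : x ∈ P.gr k) :
    ⁅h, x⁆ ∈ P.gr k := by
  simpa using P.lie_mem_gr (C.h0_le hh) hx

theorem lie_comm_of_mem_h0 {h h' : P.g} (hh : h ∈ C.h0) (hh' : h' ∈ C.h0) (x : P.g) :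
    ⁅h, ⁅h', x⁆⁆ = ⁅h', ⁅h, x⁆⁆ := by
  rw [leibniz_lie, C.h0_abelian h hh h' hh', zero_lie, zero_add]

theorem h0_le_wtg_zero {r : Fin P.n → ℤ} (hr : P.inΓ r) {h : P.g} (hh : h ∈ C.h0) :
    h ∈ C.wtg r 0 := by
  rw [mem_wtg, P.gr_of_inΓ hr]
  exact ⟨C.h0_le hh, fun h' => by simp [C.h0_abelian h' h'.2 h hh]⟩

/-- The quotient of the `𝔥_{0̄}`-module `𝔤_{0̄}` by `𝔥_{0̄}`. -/
abbrev Quot0 : Type := ↥(P.gr 0) ⧸ C.h0.submoduleOf (P.gr 0)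

/-- The action of `𝔥_{0̄}` on `𝔤_{0̄} / 𝔥_{0̄}`. -/
def quotAd (h : C.h0) : Module.End ℂ C.Quot0 :=
  Submodule.mapQ _ _
    ((LieAlgebra.ad ℂ P.g (h : P.g)).restrict fun _ hx => C.lie_mem_gr_of_mem_h0 h.2 hx)
    fun x hx => by
      have h0 : ⁅(h : P.g), (x : P.g)⁆ = 0 := C.h0_abelian h h.2 x hx
      change ⁅(h : P.g), (x : P.g)⁆ ∈ C.h0
      exact h0 ▸ C.h0.zero_mem

theorem quotAd_mk (h : C.h0) (x : ↥(P.gr 0)) :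
    C.quotAd h (Submodule.Quotient.mk x) =
      Submodule.Quotient.mk ⟨⁅(h : P.g), (x : P.g)⁆, C.lie_mem_gr_of_mem_h0 h.2 x.2⟩ := rfl

theorem quot_mk_eq_zero {x : ↥(P.gr 0)} :
    (Submodule.Quotient.mk x : C.Quot0) = 0 ↔ (x : P.g) ∈ C.h0 := by
  rw [Submodule.Quotient.mk_eq_zero]; rfl

theorem quotAd_comm (h k : C.h0) (v : C.Quot0) :
    C.quotAd h (C.quotAd k v) = C.quotAd k (C.quotAd h v) := by
  obtain ⟨x, rfl⟩ := Submodule.Quotient.mk_surjective _ v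
  simp only [quotAd_mk]
  congr 2
  exact C.lie_comm_of_mem_h0 h.2 k.2 x

/-- As `𝔥_{0̄}` is self-normalizing, no nonzero vector of `𝔤_{0̄} / 𝔥_{0̄}` is invariant. -/
theorem quotAd_eq_zero {v : C.Quot0} (hv : ∀ h, C.quotAd h v = 0) : v = 0 := by
  obtain ⟨x, rfl⟩ := Submodule.Quotient.mk_surjective _ v
  rw [quot_mk_eq_zero]
  refine C.h0_selfnorm x x.2 fun h hh => ?_
  have := hv ⟨h, hh⟩
  rwa [quotAd_mk, quot_mk_eq_zero] at this

instance : FiniteDimensional ℂ P.g := P.gfin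

/-- The invariant form does not vanish on `𝔥_{0̄}`. -/
theorem exists_bil_h0_ne_zero : ∃ h ∈ C.h0, ∃ h' ∈ C.h0, P.bil h h' ≠ 0 := by
  obtain ⟨h, hh, hh0⟩ := C.h0.ne_bot_iff.mp C.h0_ne
  refine ⟨h, hh, ?_⟩
  by_contra! hbil
  obtain ⟨y, hy, hy0⟩ := P.exists_bil_ne_zero (C.h0_le hh) hh0
  rw [neg_zero] at hy
  let φ : C.Quot0 →ₗ[ℂ] ℂ := Submodule.liftQ _ ((P.bil h).comp (P.gr 0).subtype)
    fun x hx => hbil x hx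
  have hφ : φ ≠ 0 := fun h0 => hy0 (LinearMap.congr_fun h0 (Submodule.Quotient.mk ⟨y, hy⟩))
  obtain ⟨v, hv0, hv⟩ := exists_common_ker_of_invariant_functional C.quotAd C.quotAd_comm φ hφ
    fun h' v => by
      obtain ⟨x, rfl⟩ := Submodule.Quotient.mk_surjective _ v
      change P.bil h ⁅(h' : P.g), (x : P.g)⁆ = 0
      rw [← P.bil_invariant, C.h0_abelian h hh h' h'.2, map_zero, LinearMap.zero_apply]
  exact hv0 (C.quotAd_eq_zero hv)

/-- A nonabelian `𝔤_{0̄}` has a nonzero root. -/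
theorem Δen_nonempty (hna : ∃ x ∈ P.gr 0, ∃ y ∈ P.gr 0, ⁅x, y⁆ ≠ 0) : C.Δen.Nonempty := by
  have hnt : Nontrivial C.Quot0 := by
    by_contra hnt
    rw [not_nontrivial_iff_subsingleton] at hnt
    have hle : ∀ x ∈ P.gr 0, x ∈ C.h0 := fun x hx =>
      (C.quot_mk_eq_zero (x := ⟨x, hx⟩)).mp (Subsingleton.elim _ _)
    obtain ⟨x, hx, y, hy, hxy⟩ := hna
    exact hxy (C.h0_abelian x (hle x hx) y (hle y hy))
  obtain ⟨v, hv0, c, hc⟩ := exists_common_eigenvector C.quotAd C.quotAd_comm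
  obtain ⟨h, hch⟩ : ∃ h, c h ≠ 0 := by
    by_contra! h0
    exact hv0 (C.quotAd_eq_zero fun h => by rw [hc, h0, zero_smul])
  obtain ⟨x, rfl⟩ := Submodule.Quotient.mk_surjective _ v
  have hd := hc h
  rw [quotAd_mk, ← Submodule.Quotient.mk_smul, Submodule.Quotient.eq] at hd
  replace hd : ⁅(h : P.g), (x : P.g)⁆ - c h • (x : P.g) ∈ C.h0 := hd
  set d := ⁅(h : P.g), (x : P.g)⁆ - c h • (x : P.g) with hddef
  let W : Submodule ℂ P.g :=
    P.gr 0 ⊓ LinearMap.ker (LieAlgebra.ad ℂ P.g (h : P.g) - c h • (1 : Module.End ℂ P.g))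
  have hW : ∀ y, y ∈ W ↔ y ∈ P.gr 0 ∧ ⁅(h : P.g), y⁆ = c h • y := fun y => by
    simp [W, sub_eq_zero]
  have hxW : (x : P.g) + (c h)⁻¹ • d ∈ W := by
    rw [hW]
    refine ⟨(P.gr 0).add_mem x.2 ((P.gr 0).smul_mem _ (C.h0_le hd)), ?_⟩
    rw [lie_add, lie_smul, C.h0_abelian h h.2 d hd, smul_add, smul_smul, mul_inv_cancel₀ hch,
      hddef]
    simp
  have hx0 : (x : P.g) + (c h)⁻¹ • d ≠ 0 := fun h0 => hv0 <| by
    rw [quot_mk_eq_zero, eq_neg_of_add_eq_zero_left h0]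
    exact C.h0.neg_mem (C.h0.smul_mem _ hd)
  have : Nontrivial W := ⟨⟨_, hxW⟩, 0, fun h0 => hx0 (congrArg Subtype.val h0)⟩
  have hWs : ∀ (h' : C.h0), ∀ y ∈ W, LieAlgebra.ad ℂ P.g (h' : P.g) y ∈ W := fun h' y hy => by
    rw [hW] at hy ⊢
    refine ⟨C.lie_mem_gr_of_mem_h0 h'.2 hy.1, ?_⟩
    rw [LieAlgebra.ad_apply, C.lie_comm_of_mem_h0 h.2 h'.2, hy.2, lie_smul]
  obtain ⟨w, hw0, a, ha⟩ := exists_common_eigenvector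
    (fun h' : C.h0 => (LieAlgebra.ad ℂ P.g (h' : P.g)).restrict (hWs h'))
    (fun h' h'' y => Subtype.ext (C.lie_comm_of_mem_h0 h'.2 h''.2 y))
  have hw0' : (w : P.g) ≠ 0 := fun h0 => hw0 (Subtype.ext h0)
  have ha' : ∀ h' : C.h0, ⁅(h' : P.g), (w : P.g)⁆ = a h' • (w : P.g) := fun h' =>
    congrArg Subtype.val (ha h')
  let α : Module.Dual ℂ C.h0 :=
    { toFun := a
      map_add' := fun h1 h2 => smul_left_injective ℂ hw0' <| by
        simp only [← ha', add_smul, Submodule.coe_add, add_lie]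
      map_smul' := fun s h1 => smul_left_injective ℂ hw0' <| by
        simp only [← ha', RingHom.id_apply, smul_eq_mul, mul_smul, Submodule.coe_smul, smul_lie] }
  refine ⟨α, fun h0 => hch ?_, 0, ?_⟩
  · have h1 : a h = 0 := LinearMap.congr_fun h0 h
    have h2 := ha' h
    rw [((hW w).mp w.2).2, h1, zero_smul] at h2
    exact (smul_eq_zero.mp h2).resolve_right hw0'
  · rw [Submodule.ne_bot_iff]
    exact ⟨w, C.mem_wtg.mpr ⟨((hW w).mp w.2).1, ha'⟩, hw0'⟩

end Cartan

namespace TRep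

variable {P : PreT} {C : Cartan P} {T : Torus P C} {X : Toroidal P C T} (M : TRep X)

theorem ρ_mul_apply (a b : X.τ) (v : M.V) :
    M.ρ a (M.ρ b v) = M.ρ b (M.ρ a v) + M.ρ ⁅a, b⁆ v := by
  simp [M.ρ_lie]

theorem mem_wtSp {w : C.Wt} {v : M.V} : v ∈ M.wtSp w ↔
    (∀ h : C.h0, M.ρ (X.E 0 (h : P.g)) v = w.1 h • v) ∧
    (∀ i, M.ρ (X.K 0 i) v = w.2.1 i • v) ∧ ∀ i, M.ρ (X.Dop 0 i) v = w.2.2 i • v := by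
  simp [wtSp, sub_eq_zero, and_assoc]

theorem mem_Vplus {v : M.V} : v ∈ M.Vplus ↔ ∀ t ∈ X.tauP, M.ρ t v = 0 := by
  simp [Vplus]

/-- `x ⊗ t^k` and `t^r Kᵢ` commute. -/
theorem ρ_E_K {k : Fin P.n → ℤ} {x : P.g} (hx : x ∈ P.gr k) (r : Fin P.n → ℤ) (i : Fin P.n)
    (v : M.V) : M.ρ (X.E k x) (M.ρ (X.K r i) v) = M.ρ (X.K r i) (M.ρ (X.E k x) v) := by
  rw [M.ρ_mul_apply, X.br_EK k x hx, map_zero, LinearMap.zero_apply, add_zero]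

theorem ρ_K_K (r s : Fin P.n → ℤ) (i j : Fin P.n) (v : M.V) :
    M.ρ (X.K r i) (M.ρ (X.K s j) v) = M.ρ (X.K s j) (M.ρ (X.K r i) v) := by
  rw [M.ρ_mul_apply, X.br_KK, map_zero, LinearMap.zero_apply, add_zero]

/-- The operator by which `Σᵢ uᵢ t^p Kᵢ` acts. -/
def κ (u p : Fin P.n → ℤ) : Module.End ℂ M.V := M.ρ (∑ i, (u i : ℂ) • X.K p i)

theorem κ_apply (u p : Fin P.n → ℤ) (v : M.V) :
    M.κ u p v = ∑ i, (u i : ℂ) • M.ρ (X.K p i) v := by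
  simp [κ]

theorem κ_sub (u u' p : Fin P.n → ℤ) (v : M.V) : M.κ (u - u') p v = M.κ u p v - M.κ u' p v := by
  simp [κ_apply, sub_smul]

theorem κ_eq_zero {p : Fin P.n → ℤ} (hp : ¬ P.inΓ p) (u : Fin P.n → ℤ) : M.κ u p = 0 := by
  simp [κ, X.K_not p _ hp]

theorem E_κ {k : Fin P.n → ℤ} {x : P.g} (hx : x ∈ P.gr k) (u p : Fin P.n → ℤ)
    (v : M.V) : M.ρ (X.E k x) (M.κ u p v) = M.κ u p (M.ρ (X.E k x) v) := by
  simp [κ_apply, M.ρ_E_K hx]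

theorem κ_κ (u p u' p' : Fin P.n → ℤ) (v : M.V) :
    M.κ u p (M.κ u' p' v) = M.κ u' p' (M.κ u p v) := by
  rw [κ_apply, κ_apply, κ_apply]
  simp only [map_sum, map_smul, κ_apply, Finset.smul_sum]
  rw [Finset.sum_comm]
  refine Finset.sum_congr rfl fun i _ => Finset.sum_congr rfl fun j _ => ?_
  rw [M.ρ_K_K, smul_comm]

theorem E_E {k l : Fin P.n → ℤ} {x y : P.g} (hx : x ∈ P.gr k) (hy : y ∈ P.gr l) (v : M.V) :
    M.ρ (X.E k x) (M.ρ (X.E l y) v) = M.ρ (X.E l y) (M.ρ (X.E k x) v) +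
      (M.ρ (X.E (k + l) ⁅x, y⁆) v + P.bil x y • M.κ k (k + l) v) := by
  rw [M.ρ_mul_apply, X.br_EE k l x y hx hy, map_add, map_smul]
  rfl

/-- The weight obtained from `w` by shifting the degree by `j`. -/
def shiftWt (w : C.Wt) (j : Fin P.n → ℤ) : C.Wt := (w.1, w.2.1, fun i => w.2.2 i + j i)

/-- Vectors killed by all of `𝒵(m)` span a submodule, so one nonzero such vector suffices. -/
theorem Ztrivial_of_exists (hirr : M.Irr) {v : M.V} (hv0 : v ≠ 0)
    (hv : ∀ r, P.inΓ r → ∀ i, M.ρ (X.K r i) v = 0) : M.Ztrivial := by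
  let W : Submodule ℂ M.V := ⨅ r, ⨅ i, LinearMap.ker (M.ρ (X.K r i))
  have hW : ∀ u, u ∈ W ↔ ∀ r i, M.ρ (X.K r i) u = 0 := fun u => by simp [W]
  have hvW : v ∈ W := (hW v).mpr fun r i => by
    by_cases hr : P.inΓ r
    · exact hv r hr i
    · simp [X.K_not r i hr]
  have hstab : ∀ t : X.τ, ∀ u ∈ W, M.ρ t u ∈ W := by
    intro t
    have ht : t ∈ (⊤ : Submodule ℂ X.τ) := trivial
    rw [← X.span_top] at ht
    induction ht using Submodule.span_induction with
    | zero => intro u _; simp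
    | add a b _ _ ha hb => intro u hu; rw [map_add]; exact W.add_mem (ha u hu) (hb u hu)
    | smul c a _ ha => intro u hu; rw [map_smul]; exact W.smul_mem c (ha u hu)
    | mem t ht =>
      intro u hu
      have hu' := (hW u).mp hu
      rw [hW]
      intro s j
      rcases ht with (⟨k, x, hx, rfl⟩ | ⟨r, i, hr, rfl⟩) | ⟨r, i, hr, rfl⟩
      · rw [← M.ρ_E_K hx, hu', map_zero]
      · rw [hu', map_zero]
      · by_cases hs : P.inΓ s
        · have h1 := M.ρ_mul_apply (X.Dop r i) (X.K s j) u
          have h2 : M.ρ ⁅X.Dop r i, X.K s j⁆ u = 0 := by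
            rw [X.br_DK r s hr hs]
            split_ifs <;> simp [hu']
          rw [h2, hu', map_zero, add_zero] at h1
          exact h1.symm
        · simp [X.K_not s j hs]
  rcases hirr.2 W hstab with h | h
  · exact absurd ((Submodule.mem_bot ℂ).mp (h ▸ hvW)) hv0
  · intro r _ i
    ext u
    exact (hW u).mp (h ▸ trivial) r i

/-- A vector killed by all `κ u p` with `u ∈ Γ` is killed by all of `𝒵(m)`. -/
theorem K_eq_zero_of_κ {v : M.V} {p : Fin P.n → ℤ} (h : ∀ u, P.inΓ u → M.κ u p v = 0)
    (i : Fin P.n) : M.ρ (X.K p i) v = 0 := by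
  have h1 := h (Pi.single i (P.m i : ℤ)) fun j => by
    rcases eq_or_ne j i with rfl | hj
    · simp
    · simp [hj]
  rw [κ_apply, Finset.sum_eq_single i (fun j _ hj => by simp [hj]) (by simp)] at h1
  simp only [Pi.single_eq_same, Int.cast_natCast] at h1
  exact (smul_eq_zero.mp h1).resolve_left (by exact_mod_cast (P.mpos i).ne')

theorem E_mem_wtSp_Dop {l : Fin P.n → ℤ} {x : P.g} (hx : x ∈ P.gr l) {v : M.V} {i : Fin P.n}
    {c : ℂ} (hv : M.ρ (X.Dop 0 i) v = c • v) :
    M.ρ (X.Dop 0 i) (M.ρ (X.E l x) v) = (c + l i) • M.ρ (X.E l x) v := by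
  rw [M.ρ_mul_apply, hv, X.br_DE 0 P.inΓ_zero i l x hx, zero_add, map_smul, map_smul, add_smul]
  rfl

/-- The part of degree `j` (relative to the weight `w`) of the highest weight space. -/
def hwSp (w : C.Wt) (j : Fin P.n → ℤ) : Submodule ℂ M.V := M.Vplus ⊓ M.wtSp (shiftWt w j)

theorem κ_mem_hwSp {w : C.Wt} {j u p : Fin P.n → ℤ} {v : M.V} (hv : v ∈ M.hwSp w j) :
    M.κ u p v ∈ M.hwSp w (p + j) := by
  by_cases hp : P.inΓ p
  swap
  · rw [M.κ_eq_zero hp]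
    exact Submodule.zero_mem _
  obtain ⟨hv1, hv2⟩ := hv
  replace hv2 := M.mem_wtSp.mp hv2
  refine ⟨M.mem_Vplus.mpr ?_, M.mem_wtSp.mpr ⟨fun h => ?_, fun i => ?_, fun i => ?_⟩⟩
  · rintro _ ⟨α, hα, k, x, hx, rfl⟩
    rw [M.E_κ hx.1, M.mem_Vplus.mp hv1 _ ⟨α, hα, k, x, hx, rfl⟩, map_zero]
  · rw [M.E_κ (C.h0_le h.2), hv2.1, map_smul]
    rfl
  · rw [κ_apply, map_sum, Finset.smul_sum]
    refine Finset.sum_congr rfl fun a _ => ?_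
    rw [map_smul, M.ρ_K_K, hv2.2.1, map_smul, smul_comm]
    rfl
  · rw [κ_apply, map_sum, Finset.smul_sum]
    refine Finset.sum_congr rfl fun a _ => ?_
    rw [map_smul, M.ρ_mul_apply, hv2.2.2, X.br_DK 0 p P.inΓ_zero hp]
    simp only [shiftWt, map_smul, zero_add, Pi.zero_apply, Int.cast_zero,
      zero_smul, Finset.sum_const_zero, smul_zero, add_zero, Pi.add_apply, Int.cast_add,
      LinearMap.smul_apply]
    module

theorem h_mem_hwSp {w : C.Wt} {j r : Fin P.n → ℤ} (hr : P.inΓ r) {h : P.g} (hh : h ∈ C.h0)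
    {v : M.V} (hv : v ∈ M.hwSp w j) : M.ρ (X.E r h) v ∈ M.hwSp w (r + j) := by
  have hhr : h ∈ P.gr r := (C.h0_le_wtg_zero hr hh).1
  obtain ⟨hv1, hv2⟩ := hv
  replace hv2 := M.mem_wtSp.mp hv2
  refine ⟨M.mem_Vplus.mpr ?_, M.mem_wtSp.mpr ⟨fun h' => ?_, fun i => ?_, fun i => ?_⟩⟩
  · rintro _ ⟨α, hα, k, x, hx, rfl⟩
    obtain ⟨hx1, hx2⟩ := C.mem_wtg.mp hx
    have hbil : P.bil x h = 0 := by
      obtain ⟨h', hh'⟩ := DFunLike.ne_iff.mp (T.pos_sub hα).1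
      have h1 : α h' * P.bil x h = 0 := by
        rw [← smul_eq_mul, ← LinearMap.smul_apply, ← map_smul, ← hx2, ← lie_skew, map_neg,
          LinearMap.neg_apply, P.bil_invariant, C.h0_abelian h' h'.2 h hh, map_zero, neg_zero]
      exact (mul_eq_zero.mp h1).resolve_left hh'
    have hlie : ⁅x, h⁆ ∈ C.wtg (k + r) α := by
      rw [← lie_skew, hx2 ⟨h, hh⟩, add_comm, Cartan.wtg, P.gr_add_of_inΓ k hr]
      exact Submodule.neg_mem _ (Submodule.smul_mem _ _ hx)
    rw [M.E_E hx1 hhr, M.mem_Vplus.mp hv1 _ ⟨α, hα, k, x, hx, rfl⟩, hbil,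
      M.mem_Vplus.mp hv1 _ ⟨α, hα, k + r, _, hlie, rfl⟩]
    simp
  · rw [M.E_E (C.h0_le h'.2) hhr, hv2.1, C.h0_abelian h' h'.2 h hh]
    simp [κ_apply, shiftWt]
  · rw [← M.ρ_E_K hhr, hv2.2.1, map_smul]
    rfl
  · rw [M.E_mem_wtSp_Dop hhr (hv2.2.2 i)]
    simp only [shiftWt, Pi.add_apply, Int.cast_add]
    congr 1
    ring

/-- The vectors of degree `d` (relative to `w`) obtained by applying `𝔤_{q̄} ⊗ ℂ[t^{±1}]` to the
`Γ`-orbit of degrees of the highest weight space. -/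
def lowered (w : C.Wt) (q d : Fin P.n → ℤ) : Submodule ℂ M.V :=
  Submodule.span ℂ {y | ∃ j, P.inΓ j ∧ ∃ f ∈ P.gr q, ∃ v ∈ M.hwSp w j,
    y = M.ρ (X.E (d - j + q) f) v}

theorem lowered_fg (hfin : M.FinWt) (w : C.Wt) (q : Fin P.n → ℤ) {d : Fin P.n → ℤ}
    (hd : P.inΓ d) : (M.lowered w q d).FG := by
  have hgr : ∀ {j}, P.inΓ j → P.gr (d - j + q) = P.gr q := fun hj =>
    P.gr_add_of_inΓ q (hd.sub hj)
  have hact : ∀ (h : C.h0) (j), P.inΓ j → ∀ f ∈ P.gr q, ∀ v ∈ M.hwSp w j,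
      M.ρ (X.E 0 (h : P.g)) (M.ρ (X.E (d - j + q) f) v) =
        w.1 h • M.ρ (X.E (d - j + q) f) v + M.ρ (X.E (d - j + q) ⁅(h : P.g), f⁆) v := by
    intro h j hj f hf v hv
    rw [M.E_E (C.h0_le h.2) (by rwa [hgr hj]), (M.mem_wtSp.mp hv.2).1, map_smul, zero_add]
    simp [κ_apply, shiftWt]
  let b := Module.finBasis ℂ C.h0
  have hwt : ∀ y ∈ M.lowered w q d, (∀ i, M.ρ (X.K 0 i) y = w.2.1 i • y) ∧
      ∀ i, M.ρ (X.Dop 0 i) y = (w.2.2 i + (d + q) i) • y := by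
    intro y hy
    induction hy using Submodule.span_induction with
    | zero => simp
    | add y z _ _ hy hz => simp [hy, hz]
    | smul c y _ hy =>
      refine ⟨fun i => ?_, fun i => ?_⟩
      · rw [map_smul, hy.1, smul_comm]
      · rw [map_smul, hy.2, smul_comm]
    | mem y hy =>
      obtain ⟨j, hj, f, hf, v, hv, rfl⟩ := hy
      obtain ⟨_, hv2, hv3⟩ := M.mem_wtSp.mp hv.2
      rw [← hgr hj] at hf
      refine ⟨fun i => ?_, fun i => ?_⟩
      · rw [← M.ρ_E_K hf, hv2, map_smul]
        rfl
      · rw [M.E_mem_wtSp_Dop hf (hv3 i)]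
        simp only [shiftWt, Pi.add_apply, Pi.sub_apply, Int.cast_add, Int.cast_sub]
        congr 1
        ring
  refine fg_of_joint_eigenspaces_fg _ (fun a => M.ρ (X.E 0 (b a : P.g))) _ ?_ ?_ ?_ ?_
  · intro a a' v
    rw [M.E_E (C.h0_le (b a).2) (C.h0_le (b a').2), C.h0_abelian _ (b a).2 _ (b a').2]
    simp [κ_apply]
  · intro a y hy
    induction hy using Submodule.span_induction with
    | zero => simp
    | add y z _ _ hy hz => rw [map_add]; exact Submodule.add_mem _ hy hz
    | smul c y _ hy => rw [map_smul]; exact Submodule.smul_mem _ c hy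
    | mem y hy =>
      obtain ⟨j, hj, f, hf, v, hv, rfl⟩ := hy
      rw [hact _ j hj f hf v hv]
      exact Submodule.add_mem _
        (Submodule.smul_mem _ _ (Submodule.subset_span ⟨j, hj, f, hf, v, hv, rfl⟩))
        (Submodule.subset_span ⟨j, hj, _, C.lie_mem_gr_of_mem_h0 (b a).2 hf, v, hv, rfl⟩)
  · intro a
    let A : Module.End ℂ P.g := LieAlgebra.ad ℂ P.g (b a : P.g)
    let N : Module.End ℂ M.V := M.ρ (X.E 0 (b a : P.g))
    refine ⟨A.charpoly.comp (Polynomial.X - Polynomial.C (w.1 (b a))), ?_, fun y hy => ?_⟩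
    · exact (A.charpoly_monic.comp (Polynomial.monic_X_sub_C _) (by simp)).ne_zero
    · rw [Polynomial.aeval_comp]
      have hN : Polynomial.aeval N (Polynomial.X - Polynomial.C (w.1 (b a))) =
          N - w.1 (b a) • 1 := by
        simp [Algebra.algebraMap_eq_smul_one]
      change Polynomial.aeval (Polynomial.aeval N _) A.charpoly y = 0
      rw [hN]
      induction hy using Submodule.span_induction with
      | zero => simp
      | add y z _ _ hy hz => rw [map_add, hy, hz, add_zero]
      | smul c y _ hy => rw [map_smul, hy, smul_zero]
      | mem y hy =>
        obtain ⟨j, hj, f, hf, v, hv, rfl⟩ := hy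
        have hpow : ∀ n : ℕ, (A ^ n) f ∈ P.gr q ∧ ((N - w.1 (b a) • 1) ^ n)
            (M.ρ (X.E (d - j + q) f) v) = M.ρ (X.E (d - j + q) ((A ^ n) f)) v := by
          intro n
          induction n with
          | zero => simpa using hf
          | succ n ih =>
            rw [pow_succ', pow_succ', Module.End.mul_apply, Module.End.mul_apply, ih.2]
            refine ⟨C.lie_mem_gr_of_mem_h0 (b a).2 ih.1, ?_⟩
            rw [LinearMap.sub_apply, hact _ j hj _ ih.1 v hv]
            simp [A]
        have hpoly : ∀ p : Polynomial ℂ, Polynomial.aeval (N - w.1 (b a) • 1) p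
            (M.ρ (X.E (d - j + q) f) v) =
              M.ρ (X.E (d - j + q) (Polynomial.aeval A p f)) v := by
          intro p
          simp only [Polynomial.aeval_eq_sum_range, LinearMap.sum_apply, LinearMap.smul_apply,
            map_sum, map_smul, (hpow _).2]
        rw [hpoly, LinearMap.aeval_self_charpoly]
        simp
  · intro c
    let ν : C.Wt := (b.constr ℂ c, w.2.1, fun i => w.2.2 i + (d + q) i)
    have := hfin ν
    refine Module.Finite.iff_fg.mp (Submodule.finiteDimensional_of_le (S₂ := M.wtSp ν) ?_)
    rintro y ⟨hy, hy'⟩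
    obtain ⟨hy2, hy3⟩ := hwt y hy
    refine M.mem_wtSp.mpr ⟨fun h => ?_, hy2, hy3⟩
    have hb : ∀ a, M.ρ (X.E 0 (b a : P.g)) y = c a • y := by
      simpa [sub_eq_zero] using hy'
    let F : C.h0 →ₗ[ℂ] M.V :=
      (LinearMap.applyₗ y).comp (M.ρ.comp ((X.E 0).comp C.h0.subtype))
    have hF : F = (LinearMap.toSpanSingleton ℂ M.V y).comp (b.constr ℂ c) :=
      b.ext fun a => by simpa [F] using hb a
    exact LinearMap.congr_fun hF h

/-- The operator on families of vectors which shifts degrees by `a` and applies `A`. -/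
def shiftOp {ι V : Type*} [AddGroup ι] [AddCommGroup V] [Module ℂ V] (a : ι)
    (A : Module.End ℂ V) : Module.End ℂ (ι → V) :=
  LinearMap.pi fun i => A.comp (LinearMap.proj (i - a))

theorem shiftOp_apply {ι V : Type*} [AddGroup ι] [AddCommGroup V] [Module ℂ V] (a : ι)
    (A : Module.End ℂ V) (x : ι → V) (i : ι) : shiftOp a A x i = A (x (i - a)) := rfl

/-- The span of the families `(κ u (i - j) v)ᵢ` with `v` in the highest weight space of
degree `j ∈ Γ`. -/
def rowSp (w : C.Wt) (u : Fin P.n → ℤ) : Submodule ℂ ((Fin P.n → ℤ) → M.V) :=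
  Submodule.span ℂ {x | ∃ j, P.inΓ j ∧ ∃ v ∈ M.hwSp w j, x = fun i => M.κ u (i - j) v}

theorem rowSp_fg (hfin : M.FinWt) (w : C.Wt) {u : Fin P.n → ℤ} (hu : P.inΓ u) :
    (M.rowSp w u).FG := by
  classical
  obtain ⟨α, hα⟩ : T.pos.Nonempty := by
    obtain ⟨α, hα⟩ := C.Δen_nonempty T.g0_nonabelian
    exact (T.pos_total α hα).elim (fun h => ⟨_, h⟩) fun h => ⟨_, h⟩
  obtain ⟨k, hk⟩ := (T.pos_sub hα).2
  obtain ⟨e, he, he0⟩ := (Submodule.ne_bot_iff _).mp hk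
  obtain ⟨f, hf, hef⟩ := P.exists_bil_ne_zero he.1 he0
  let B : (Fin P.n → ℤ) → M.V →ₗ[ℂ] ((Fin P.n → ℤ) → M.V) := fun d =>
    LinearMap.pi fun i => if P.inΓ i then M.ρ (X.E (i - d + k) e) else 0
  have hFG : ((M.lowered w (-k) 0).map (B 0) ⊔ (M.lowered w (-k) u).map (B u)).FG :=
    ((M.lowered_fg hfin w (-k) P.inΓ_zero).map _).sup ((M.lowered_fg hfin w (-k) hu).map _)
  have := Module.Finite.iff_fg.mpr hFG
  refine Module.Finite.iff_fg.mp (Submodule.finiteDimensional_of_le (Submodule.span_le.mpr ?_)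
    (S₂ := (M.lowered w (-k) 0).map (B 0) ⊔ (M.lowered w (-k) u).map (B u)))
  rintro _ ⟨j, hj, v, hv, rfl⟩
  have hcomm : ∀ d, P.inΓ d → ∀ i, P.inΓ i →
      M.ρ (X.E (i - d + k) e) (M.ρ (X.E (d - j + -k) f) v) =
        M.ρ (X.E (i - j) ⁅e, f⁆) v + P.bil e f • M.κ (i - d + k) (i - j) v := by
    intro d hd i hi
    have he' : e ∈ C.wtg (i - d + k) α := by
      rw [Cartan.wtg, P.gr_add_of_inΓ k (hi.sub hd)]
      exact he
    have hf' : f ∈ P.gr (d - j + -k) := by rwa [P.gr_add_of_inΓ (-k) (hd.sub hj)]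
    have hev : M.ρ (X.E (i - d + k) e) v = 0 :=
      M.mem_Vplus.mp hv.1 _ ⟨α, hα, _, e, he', rfl⟩
    have hdeg : i - d + k + (d - j + -k) = i - j := by abel
    rw [M.E_E he'.1 hf', hev, hdeg, map_zero, zero_add]
  have hrow : (fun i => M.κ u (i - j) v) = (P.bil e f)⁻¹ •
      (B 0 (M.ρ (X.E (0 - j + -k) f) v) - B u (M.ρ (X.E (u - j + -k) f) v)) := by
    funext i
    by_cases hi : P.inΓ i
    · have hsub : M.κ (i - 0 + k) (i - j) v - M.κ (i - u + k) (i - j) v = M.κ u (i - j) v := by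
        rw [← κ_sub]
        congr 2
        abel
      simp only [B, Pi.smul_apply, Pi.sub_apply, LinearMap.pi_apply, if_pos hi,
        hcomm 0 P.inΓ_zero i hi, hcomm u hu i hi, add_sub_add_left_eq_sub, ← smul_sub, hsub,
        smul_smul, inv_mul_cancel₀ hef, one_smul]
    · have hij : ¬ P.inΓ (i - j) := fun h => hi (by simpa using h.add hj)
      simp [B, hi, M.κ_eq_zero hij]
  have hmem : ∀ d, M.ρ (X.E (d - j + -k) f) v ∈ M.lowered w (-k) d := fun d =>
    Submodule.subset_span ⟨j, hj, f, hf, v, hv, rfl⟩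
  rw [SetLike.mem_coe, hrow]
  exact Submodule.smul_mem _ _ (Submodule.sub_mem _
    (Submodule.mem_sup_left (Submodule.mem_map_of_mem (hmem 0)))
    (Submodule.mem_sup_right (Submodule.mem_map_of_mem (hmem u))))

theorem shiftOp_mem_rowSp {w : C.Wt} {u a : Fin P.n → ℤ} (ha : P.inΓ a) {A : Module.End ℂ M.V}
    (hA : ∀ j, ∀ v ∈ M.hwSp w j, A v ∈ M.hwSp w (a + j))
    (hκ : ∀ p v, A (M.κ u p v) = M.κ u p (A v)) {x : (Fin P.n → ℤ) → M.V}
    (hx : x ∈ M.rowSp w u) : shiftOp a A x ∈ M.rowSp w u := by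
  induction hx using Submodule.span_induction with
  | zero => simp
  | add x y _ _ hx hy => rw [map_add]; exact Submodule.add_mem _ hx hy
  | smul c x _ hx => rw [map_smul]; exact Submodule.smul_mem _ c hx
  | mem x hx =>
    obtain ⟨j, hj, v, hv, rfl⟩ := hx
    refine Submodule.subset_span ⟨a + j, ha.add hj, A v, hA j v hv, ?_⟩
    funext i
    rw [shiftOp_apply, hκ, sub_sub]

/-- A nonzero space of rows contains a nonzero row killed by `𝒵(m)`. -/
theorem exists_mem_rowSp_ker (hfin : M.FinWt) {w : C.Wt} {u : Fin P.n → ℤ} (hu : P.inΓ u)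
    (hne : M.rowSp w u ≠ ⊥) :
    ∃ v : M.V, v ≠ 0 ∧ ∀ r p, P.inΓ r → P.inΓ p → M.κ r p v = 0 := by
  obtain ⟨h, hh, h', hh', hbil⟩ := C.exists_bil_h0_ne_zero
  have hgr : ∀ {r} {h : P.g}, P.inΓ r → h ∈ C.h0 → h ∈ P.gr r := fun hr hh =>
    (C.h0_le_wtg_zero hr hh).1
  let I := {a : (Fin P.n → ℤ) × (Fin P.n → ℤ) // P.inΓ a.1 ∧ P.inΓ a.2}
  let Z : I → Module.End ℂ ((Fin P.n → ℤ) → M.V) := fun a => shiftOp a.1.2 (M.κ a.1.1 a.1.2)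
  let A : I → Module.End ℂ ((Fin P.n → ℤ) → M.V) := fun a =>
    (P.bil h h')⁻¹ • shiftOp a.1.1 (M.ρ (X.E a.1.1 h))
  let B : I → Module.End ℂ ((Fin P.n → ℤ) → M.V) := fun a =>
    shiftOp (a.1.2 - a.1.1) (M.ρ (X.E (a.1.2 - a.1.1) h'))
  have hZ : ∀ a, ∀ x ∈ M.rowSp w u, Z a x ∈ M.rowSp w u := fun a x hx =>
    M.shiftOp_mem_rowSp a.2.2 (fun j v hv => M.κ_mem_hwSp hv) (fun p v => M.κ_κ _ _ _ _ v) hx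
  have hA : ∀ a, ∀ x ∈ M.rowSp w u, A a x ∈ M.rowSp w u := fun a x hx =>
    Submodule.smul_mem _ _ (M.shiftOp_mem_rowSp a.2.1 (fun j v hv => M.h_mem_hwSp a.2.1 hh hv)
      (fun p v => M.E_κ (hgr a.2.1 hh) _ _ v) hx)
  have hB : ∀ a, ∀ x ∈ M.rowSp w u, B a x ∈ M.rowSp w u := fun a x hx =>
    M.shiftOp_mem_rowSp (a.2.2.sub a.2.1)
      (fun j v hv => M.h_mem_hwSp (a.2.2.sub a.2.1) hh' hv)
      (fun p v => M.E_κ (hgr (a.2.2.sub a.2.1) hh') _ _ v) hx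
  have := Module.Finite.iff_fg.mpr (M.rowSp_fg hfin w hu)
  have := Submodule.nontrivial_iff_ne_bot.mpr hne
  have hex : ∃ x : M.rowSp w u, x ≠ 0 ∧ ∀ a, (Z a).restrict (hZ a) x = 0 := by
    refine exists_common_ker_of_commutators
      (fun a => (Z a).restrict (hZ a)) (fun a => (A a).restrict (hA a))
      (fun a => (B a).restrict (hB a)) ?_ ?_ ?_ ?_
    · intro a b x
      refine Subtype.ext (funext fun i => ?_)
      change M.κ _ _ (M.κ _ _ (x.1 _)) = M.κ _ _ (M.κ _ _ (x.1 _))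
      rw [κ_κ, sub_right_comm]
    · intro a x
      refine Subtype.ext (funext fun i => ?_)
      change M.κ _ _ ((P.bil h h')⁻¹ • M.ρ _ (x.1 _)) =
        (P.bil h h')⁻¹ • M.ρ _ (M.κ _ _ (x.1 _))
      rw [map_smul, M.E_κ (hgr a.2.1 hh), sub_right_comm]
    · intro a x
      refine Subtype.ext (funext fun i => ?_)
      change M.κ _ _ (M.ρ _ (x.1 _)) = M.ρ _ (M.κ _ _ (x.1 _))
      rw [M.E_κ (hgr (a.2.2.sub a.2.1) hh'), sub_right_comm]
    · intro a x
      refine Subtype.ext (funext fun i => ?_)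
      change M.κ a.1.1 a.1.2 (x.1 (i - a.1.2)) =
        (P.bil h h')⁻¹ • M.ρ (X.E a.1.1 h)
          (M.ρ (X.E (a.1.2 - a.1.1) h') (x.1 (i - a.1.1 - (a.1.2 - a.1.1)))) -
        M.ρ (X.E (a.1.2 - a.1.1) h')
          ((P.bil h h')⁻¹ • M.ρ (X.E a.1.1 h) (x.1 (i - (a.1.2 - a.1.1) - a.1.1)))
      rw [map_smul, ← smul_sub, M.E_E (hgr a.2.1 hh) (hgr (a.2.2.sub a.2.1) hh'),
        C.h0_abelian h hh h' hh', sub_right_comm i]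
      simp [smul_smul, hbil, sub_sub]
  obtain ⟨x, hx0, hx⟩ := hex
  have hx0' : (x : (Fin P.n → ℤ) → M.V) ≠ 0 := fun h => hx0 (Subtype.ext h)
  obtain ⟨i, hi⟩ := Function.ne_iff.mp hx0'
  refine ⟨(x : (Fin P.n → ℤ) → M.V) i, hi, fun r p hr hp => ?_⟩
  have h1 : Z ⟨(r, p), hr, hp⟩ x = 0 := congrArg Subtype.val (hx ⟨(r, p), hr, hp⟩)
  have h2 := congrFun h1 (i + p)
  rwa [shiftOp_apply, add_sub_cancel_right] at h2

end TRep

section Statements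

variable {P : PreT} {C : Cartan P} {T : Torus P C} {X : Toroidal P C T}

/-- Theorem 4.1: if `V` is a level zero irreducible highest weight module with
finite-dimensional weight spaces on whose highest weight space `𝔥_{0̄}` acts non-trivially,
then `𝒵(m)` acts trivially on `V`. -/
theorem statement4 (M : TRep X) (hirr : M.Irr) (hhw : M.IsHW) (hfin : M.FinWt)
    (hh0 : ∃ h : ↥C.h0, ∃ v ∈ M.Vplus, M.ρ (X.E 0 (h : P.g)) v ≠ 0) :
    M.Ztrivial := by
  obtain ⟨v, hv0, ⟨w, hw⟩, -, hplus, -⟩ := hhw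
  have hv : v ∈ M.hwSp w 0 :=
    ⟨M.mem_Vplus.mpr hplus, by simpa [TRep.shiftWt] using hw⟩
  by_cases hκ : ∀ u p, P.inΓ u → M.κ u p v = 0
  · exact M.Ztrivial_of_exists hirr hv0 fun r _ => M.K_eq_zero_of_κ fun u => hκ u r
  · push Not at hκ
    obtain ⟨u, p, hu, hup⟩ := hκ
    have hne : M.rowSp w u ≠ ⊥ := by
      rw [Submodule.ne_bot_iff]
      refine ⟨_, Submodule.subset_span ⟨0, P.inΓ_zero, v, hv, rfl⟩, fun h => hup ?_⟩
      simpa using congrFun h p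
    obtain ⟨x, hx0, hx⟩ := M.exists_mem_rowSp_ker hfin hu hne
    exact M.Ztrivial_of_exists hirr hx0 fun r hr =>
      M.K_eq_zero_of_κ fun u hu => hx u r hu hr

end Statements
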